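/- arXiv:0901.4079 — 2 statements merged into one kernel-verified Lean document; each statement's English description precedes it below -/
import Mathlib

section
/- Let F be the field of rational functions in two variables a and b over ℂ (the fraction field of MvPolynomial (Fin 2) ℂ), and let P ∈ F[X] be the quartic P(X) = (X² - a)² - b, where a and b denote the images in F of the two variables. Then the Galois group of P over F is isomorphic, as a group, to the dihedral group of order eight, DihedralGroup 4. -/
open Polynomial

theorem aux_nonsq (F : Type) [Field F] [Algebra (MvPolynomial (Fin 2) ℂ) F]
    [IsFractionRing (MvPolynomial (Fin 2) ℂ) F] (q : MvPolynomial (Fin 2) ℂ) (u v : ℂ[X])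
    (h : Odd (MvPolynomial.aeval ![u, v] q).natDegree) (y : F) :
    y ^ 2 ≠ algebraMap (MvPolynomial (Fin 2) ℂ) F q := by
  intro hy
  obtain ⟨p, hp⟩ := IsIntegrallyClosed.exists_algebraMap_eq_of_isIntegral_pow
    (R := MvPolynomial (Fin 2) ℂ) (x := y) (n := 2) (by norm_num)
    (by rw [hy]; exact isIntegral_algebraMap)
  rw [← hp, ← map_pow] at hy
  have h2 := IsFractionRing.injective (MvPolynomial (Fin 2) ℂ) F hy
  rw [← h2, map_pow, natDegree_pow] at h
  exact (Nat.not_odd_iff_even.2 (even_two_mul _)) h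

open DihedralGroup in
theorem aux_group {G : Type*} [Group G] (g h : G) (hg : g ^ 4 = 1) (hh : h * h = 1)
    (hgh : g * h = h * g⁻¹) :
    ∃ f : DihedralGroup 4 →* G, f (r 1) = g ∧ f (sr 0) = h := by
  have hK : zmultiplesHom (Additive G) (Additive.ofMul g) ((4 : ℕ) : ℤ) = 0 := by
    rw [zmultiplesHom_apply, natCast_zsmul, ← ofMul_pow, hg, ofMul_one]
  let K : ZMod 4 →+ Additive G := ZMod.lift 4 ⟨zmultiplesHom (Additive G) (Additive.ofMul g), hK⟩
  let k : ZMod 4 → G := fun i => (K i).toMul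
  have kadd : ∀ i j, k (i + j) = k i * k j := fun i j => by simp [k]
  have kneg : ∀ i, k (-i) = (k i)⁻¹ := fun i => by simp [k]
  have k0 : k 0 = 1 := by simp [k]
  have k1 : k 1 = g := by
    have := ZMod.lift_coe 4 ⟨zmultiplesHom (Additive G) (Additive.ofMul g), hK⟩ 1
    simp only [k, K]
    rw [← Int.cast_one, this]; simp
  have kh : ∀ i, k i * h = h * k (-i) := by
    have step : ∀ n : ℕ, k n * h = h * (k n)⁻¹ := by
      intro n
      induction n with
      | zero => simp [k0]
      | succ n ih =>
        push_cast
        rw [kadd, k1, mul_assoc, hgh, ← mul_assoc, ih, mul_inv_rev, mul_assoc, ← mul_inv_rev,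
          ← mul_inv_rev]
        congr 2
        rw [← k1, ← kadd, ← kadd, add_comm]
    intro i
    rw [kneg]
    simpa using step i.val
  refine ⟨⟨⟨fun x => match x with | r i => k i | sr i => h * k i, ?_⟩, ?_⟩, ?_, ?_⟩
  · exact k0
  · rintro (i | i) (j | j)
    · simp [kadd]
    · simp only [r_mul_sr]
      rw [← mul_assoc, kh, mul_assoc, ← kadd]; congr 2; ring
    · simp [kadd, mul_assoc]
    · simp only [sr_mul_sr]
      rw [mul_assoc, ← mul_assoc (k i), kh, ← mul_assoc, ← mul_assoc, hh, one_mul, ← kadd]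
      congr 1; ring
  · exact k1
  · change h * k 0 = h
    rw [k0, mul_one]

open DihedralGroup in
theorem aux_gal {F E : Type*} [Field F] [Field E] [CharZero F] [Algebra F E]
    [FiniteDimensional F E] [IsGalois F E]
    (a b : F) (α β s : E) (hα : α ^ 2 = algebraMap F E a + s) (hβ : β ^ 2 = algebraMap F E a - s)
    (hs : s ^ 2 = algebraMap F E b)
    (hext : ∀ σ τ : E ≃ₐ[F] E, σ α = τ α → σ β = τ β → σ = τ)
    (h1 : ∀ y : F, y ^ 2 ≠ b) (h2 : ∀ y : F, y ^ 2 ≠ a ^ 2 - b)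
    (h3 : ∀ y : F, y ^ 2 ≠ b * (a ^ 2 - b)) :
    Nonempty ((E ≃ₐ[F] E) ≃* DihedralGroup 4) := by
  have : CharZero E := charZero_of_injective_algebraMap (algebraMap F E).injective
  have move : ∀ (x : E) (c : F), x ^ 2 = algebraMap F E c → (∀ y : F, y ^ 2 ≠ c) →
      ∃ σ : E ≃ₐ[F] E, σ x = -x := by
    intro x c hx hc
    by_contra! hcon
    have : ∀ σ : E ≃ₐ[F] E, σ x = x := by
      intro σ
      have : (σ x) ^ 2 = x ^ 2 := by rw [← map_pow, hx, AlgEquiv.commutes]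
      exact (sq_eq_sq_iff_eq_or_eq_neg.1 this).resolve_right (hcon σ)
    obtain ⟨y, hy⟩ := (IsGalois.mem_range_algebraMap_iff_fixed x).2 this
    apply hc y
    apply (algebraMap F E).injective
    rw [map_pow, hy, hx]
  have hδ : (α * β) ^ 2 = algebraMap F E (a ^ 2 - b) := by
    rw [mul_pow, hα, hβ, map_sub, map_pow, ← hs]; ring
  have hsδ : (s * (α * β)) ^ 2 = algebraMap F E (b * (a ^ 2 - b)) := by
    rw [mul_pow, hδ, hs, map_mul]
  have nz : ∀ (x : E) (c : F), x ^ 2 = algebraMap F E c → (∀ y : F, y ^ 2 ≠ c) → x ≠ 0 := by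
    rintro x c hx hc rfl
    apply hc 0
    apply (algebraMap F E).injective
    rw [← hx]; simp
  have s0 : s ≠ 0 := nz s b hs h1
  have δ0 : α * β ≠ 0 := nz _ _ hδ h2
  have α0 : α ≠ 0 := left_ne_zero_of_mul δ0
  have β0 : β ≠ 0 := right_ne_zero_of_mul δ0
  have sgn : ∀ (x : E) (c : F), x ^ 2 = algebraMap F E c → ∀ σ : E ≃ₐ[F] E, 
      σ x = x ∨ σ x = -x := by
    intro x c hx σ
    apply sq_eq_sq_iff_eq_or_eq_neg.1
    rw [← map_pow, hx, AlgEquiv.commutes]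
  have ss := sgn s b hs
  have sδ := sgn _ _ hδ
  -- the action on roots
  have act_pos : ∀ σ : E ≃ₐ[F] E, σ s = s → (σ α = α ∨ σ α = -α) ∧ (σ β = β ∨ σ β = -β) := by
    intro σ h
    constructor <;> apply sq_eq_sq_iff_eq_or_eq_neg.1
    · rw [← map_pow, hα, map_add, AlgEquiv.commutes, h]
    · rw [← map_pow, hβ, map_sub, AlgEquiv.commutes, h]
  have act_neg : ∀ σ : E ≃ₐ[F] E, σ s = -s → (σ α = β ∨ σ α = -β) ∧ (σ β = α ∨ σ β = -α) := by
    intro σ h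
    constructor <;> apply sq_eq_sq_iff_eq_or_eq_neg.1
    · rw [← map_pow, hα, hβ, map_add, AlgEquiv.commutes, h]; ring
    · rw [← map_pow, hα, hβ, map_sub, AlgEquiv.commutes, h]; ring
  have ex : ∃ g h : E ≃ₐ[F] E, g s = -s ∧ g (α * β) = -(α * β) ∧ h s = s ∧
      h (α * β) = -(α * β) := by
    obtain ⟨σ, hσ⟩ := move s b hs h1
    obtain ⟨τ, hτ⟩ := move _ _ hδ h2
    obtain ⟨ρ, hρ⟩ := move _ _ hsδ h3
    have hsd : s * (α * β) ≠ 0 := mul_ne_zero s0 δ0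
    rw [map_mul] at hρ
    generalize α * β = δ at *
    rcases ss ρ with r1 | r1 <;> rcases sδ ρ with r2 | r2 <;> rw [r1, r2] at hρ
    · exact absurd hρ (by simpa [self_eq_neg] using hsd)
    · rcases sδ σ with h | h
      · exact ⟨σ * ρ, ρ, by simp [AlgEquiv.mul_apply, *]⟩
      · exact ⟨σ, ρ, by simp [*]⟩
    · rcases ss τ with h | h
      · exact ⟨τ * ρ, τ, by simp [AlgEquiv.mul_apply, *]⟩
      · exact ⟨τ, τ * ρ, by simp [AlgEquiv.mul_apply, *]⟩
    · exact absurd hρ (by simpa [self_eq_neg] using hsd)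
  have ex2 : ∃ g h : E ≃ₐ[F] E, g α = β ∧ g β = -α ∧ h α = -α ∧ h β = β := by
    obtain ⟨g, h, g1, g2, e1, e2⟩ := ex
    have hg : ∃ g : E ≃ₐ[F] E, g α = β ∧ g β = -α := by
      rw [map_mul] at g2
      rcases act_neg g g1 with ⟨u | u, v | v⟩ <;> rw [u, v] at g2
      · exact absurd g2 (by rw [mul_comm]; simpa [self_eq_neg] using δ0)
      · exact ⟨g, u, v⟩
      · exact ⟨g * g * g, by simp [AlgEquiv.mul_apply, *]⟩
      · exact absurd g2 (by rw [mul_comm]; simpa [self_eq_neg] using δ0)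
    obtain ⟨g, u, v⟩ := hg
    rw [map_mul] at e2
    rcases act_pos h e1 with ⟨p | p, q | q⟩ <;> rw [p, q] at e2
    · exact absurd e2 (by simpa [self_eq_neg] using δ0)
    · exact ⟨g, h * g * g, by simp [AlgEquiv.mul_apply, *]⟩
    · exact ⟨g, h, by simp [*]⟩
    · exact absurd e2 (by simpa [self_eq_neg] using δ0)
  obtain ⟨g, h, gα, gβ, eα, eβ⟩ := ex2
  have hg4 : g ^ 4 = 1 := by
    apply hext <;> simp [pow_succ, AlgEquiv.mul_apply, *]
  obtain ⟨f, fr, fs⟩ := aux_group g h hg4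
    (by apply hext <;> simp [AlgEquiv.mul_apply, *])
    (by
      rw [eq_mul_inv_iff_mul_eq]
      apply hext <;> simp [AlgEquiv.mul_apply, *])
  have αβ : α ≠ β := by
    rintro rfl
    rw [hα] at hβ
    apply s0
    linear_combination hβ / 2
  have αβ' : α ≠ -β := by
    intro h
    rw [h, neg_sq, hβ] at hα
    apply s0
    linear_combination -hα / 2
  have fr2 : f (r 2) = g * g := by rw [← fr, ← map_mul]; rfl
  have fr3 : f (r 3) = g * g * g := by rw [← fr, ← map_mul, ← map_mul]; rfl
  have fs1 : f (sr 1) = h * g := by rw [← fr, ← fs, ← map_mul]; rfl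
  have fs2 : f (sr 2) = h * g * g := by rw [← fr, ← fs, ← map_mul, ← map_mul]; rfl
  have fs3 : f (sr 3) = h * g * g * g := by
    rw [← fr, ← fs, ← map_mul, ← map_mul, ← map_mul]; rfl
  refine ⟨(MulEquiv.ofBijective f ⟨?_, ?_⟩).symm⟩
  · rw [injective_iff_map_eq_one]
    have nα : -α ≠ α := by simpa [neg_eq_self] using α0
    have nβ : -β ≠ β := by simpa [neg_eq_self] using β0
    have nβα : -β ≠ α := αβ'.symm
    have key : ∀ x, f x = 1 → f x α = α ∧ f x β = β := fun x hx => by simp [hx]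
    rintro (i | i) hx <;> have hk := key _ hx <;> clear hx <;> fin_cases i
    · rfl
    · change f (r 1) α = α ∧ f (r 1) β = β at hk
      simp [fr, gα, αβ.symm] at hk
    · change f (r 2) α = α ∧ f (r 2) β = β at hk
      simp [fr2, AlgEquiv.mul_apply, gα, gβ, nα] at hk
    · change f (r 3) α = α ∧ f (r 3) β = β at hk
      simp [fr3, AlgEquiv.mul_apply, gα, gβ, nβα] at hk
    · change f (sr 0) α = α ∧ f (sr 0) β = β at hk
      simp [fs, eα, nα] at hk
    · change f (sr 1) α = α ∧ f (sr 1) β = β at hk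
      simp [fs1, AlgEquiv.mul_apply, gα, eβ, αβ.symm] at hk
    · change f (sr 2) α = α ∧ f (sr 2) β = β at hk
      simp [fs2, AlgEquiv.mul_apply, gα, gβ, eα, eβ, nβ] at hk
    · change f (sr 3) α = α ∧ f (sr 3) β = β at hk
      simp [fs3, AlgEquiv.mul_apply, gα, gβ, eα, eβ, nβα] at hk
  · intro σ
    rcases ss σ with h0 | h0
    · rcases act_pos σ h0 with ⟨p | p, q | q⟩
      · exact ⟨1, by apply hext <;> simp [*]⟩
      · exact ⟨sr 2, by apply hext <;> simp [AlgEquiv.mul_apply, *]⟩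
      · exact ⟨sr 0, by apply hext <;> simp [AlgEquiv.mul_apply, *]⟩
      · exact ⟨r 2, by apply hext <;> simp [AlgEquiv.mul_apply, *]⟩
    · rcases act_neg σ h0 with ⟨p | p, q | q⟩
      · exact ⟨sr 1, by apply hext <;> simp [AlgEquiv.mul_apply, *]⟩
      · exact ⟨r 1, by apply hext <;> simp [AlgEquiv.mul_apply, *]⟩
      · exact ⟨r 3, by apply hext <;> simp [AlgEquiv.mul_apply, *]⟩
      · exact ⟨sr 3, by apply hext <;> simp [AlgEquiv.mul_apply, *]⟩

theorem aux_main {F E : Type*} [Field F] [Field E] [CharZero F] [Algebra F E]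
    [FiniteDimensional F E] [IsGalois F E] (a b : F)
    (P : Polynomial F) (hP : P = (X ^ 2 - C a) ^ 2 - C b) (hdeg : P.natDegree = 4) (hP0 : P ≠ 0)
    (hsplit : (P.map (algebraMap F E)).Splits)
    (hext : ∀ σ τ : E ≃ₐ[F] E, (∀ x ∈ P.rootSet E, σ x = τ x) → σ = τ)
    (h1 : ∀ y : F, y ^ 2 ≠ b) (h2 : ∀ y : F, y ^ 2 ≠ a ^ 2 - b)
    (h3 : ∀ y : F, y ^ 2 ≠ b * (a ^ 2 - b)) :
    Nonempty ((E ≃ₐ[F] E) ≃* DihedralGroup 4) := by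
  obtain ⟨α, hα⟩ := hsplit.exists_eval_eq_zero (by
    rw [degree_map, degree_eq_natDegree hP0, hdeg]; decide)
  have hα' : (α ^ 2 - algebraMap F E a) ^ 2 = algebraMap F E b := by
    rw [hP] at hα
    simpa [sub_eq_zero] using hα
  obtain ⟨s, hs⟩ : ∃ s, s = α ^ 2 - algebraMap F E a := ⟨_, rfl⟩
  rw [← hs] at hα'
  have hfac : (X ^ 2 - C (algebraMap F E a - s)) ∣ P.map (algebraMap F E) := by
    refine ⟨X ^ 2 - C (algebraMap F E a + s), ?_⟩
    rw [hP]
    simp only [Polynomial.map_sub, Polynomial.map_pow, map_X, map_C, ← hα', map_sub, map_add,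
      map_pow]
    ring
  have hsp2 := hsplit.of_dvd (Polynomial.map_ne_zero hP0) hfac
  have hd2 : (X ^ 2 - C (algebraMap F E a - s)).degree = 2 := 
    degree_X_pow_sub_C (by norm_num) _
  obtain ⟨β, hβ⟩ := hsp2.exists_eval_eq_zero (by rw [hd2]; decide)
  have hβ' : β ^ 2 = algebraMap F E a - s := by
    simpa [sub_eq_zero] using hβ
  refine aux_gal (E := E) a b α β s (by rw [hs]; ring) hβ' hα' ?_ h1 h2 h3
  intro σ τ e1 e2
  refine hext σ τ ?_
  intro x hx
  have hx := (mem_rootSet.1 hx).2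
  have hx' : (x ^ 2 - algebraMap F E a) ^ 2 = s ^ 2 := by
    rw [hα']
    have hx2 : aeval x ((X ^ 2 - C a) ^ 2 - C b) = 0 := by rw [← hP]; exact hx
    simpa [sub_eq_zero] using hx2
  rcases sq_eq_sq_iff_eq_or_eq_neg.1 hx' with h | h
  · have : x ^ 2 = α ^ 2 := by rw [hs] at h; linear_combination h
    rcases sq_eq_sq_iff_eq_or_eq_neg.1 this with rfl | rfl
    · exact e1
    · change σ (-α) = τ (-α)
      rw [map_neg, map_neg, e1]
  · have : x ^ 2 = β ^ 2 := by rw [hβ']; linear_combination h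
    rcases sq_eq_sq_iff_eq_or_eq_neg.1 this with rfl | rfl
    · exact e2
    · change σ (-β) = τ (-β)
      rw [map_neg, map_neg, e2]

/-- The Galois group of the quartic `(X² - a)² - b` over the field `ℂ(a,b)` of rational
functions in its parameters is the dihedral group of order eight. -/
theorem stmt10 (F : Type) [Field F] [Algebra (MvPolynomial (Fin 2) ℂ) F]
    [IsFractionRing (MvPolynomial (Fin 2) ℂ) F]
    (a b : F)
    (ha : a = algebraMap (MvPolynomial (Fin 2) ℂ) F (MvPolynomial.X 0))
    (hb : b = algebraMap (MvPolynomial (Fin 2) ℂ) F (MvPolynomial.X 1))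
    (P : Polynomial F) (hP : P = (X ^ 2 - C a) ^ 2 - C b) :
    Nonempty (P.Gal ≃* DihedralGroup 4) := by
  have hc : CharZero F := charZero_of_injective_algebraMap
    (IsFractionRing.injective (MvPolynomial (Fin 2) ℂ) F)
  have h1 : ∀ y : F, y ^ 2 ≠ b := by
    intro y
    rw [hb]
    refine aux_nonsq F _ 0 X ?_ y
    simp
  have h2 : ∀ y : F, y ^ 2 ≠ a ^ 2 - b := by
    intro y
    rw [ha, hb, ← map_pow, ← map_sub]
    refine aux_nonsq F _ 0 X ?_ y
    simp
  have h3 : ∀ y : F, y ^ 2 ≠ b * (a ^ 2 - b) := by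
    intro y
    rw [ha, hb, ← map_pow, ← map_sub, ← map_mul]
    refine aux_nonsq F _ X X ?_ y
    have : (MvPolynomial.aeval ![(X : ℂ[X]), X])
      (MvPolynomial.X 1 * (MvPolynomial.X 0 ^ 2 - MvPolynomial.X 1) :
        MvPolynomial (Fin 2) ℂ) = X ^ 3 - X ^ 2 := by
      simp; ring
    rw [this]
    have : (X ^ 3 - X ^ 2 : ℂ[X]).natDegree = 3 := by compute_degree!
    rw [this]; decide
  have hdeg : P.natDegree = 4 := by
    rw [hP]; compute_degree!
  have hP0 : P ≠ 0 := by
    rintro h; simp [h] at hdeg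
  have : IsGalois F P.SplittingField := ⟨⟩
  exact aux_main (E := P.SplittingField) a b P hP hdeg hP0 (SplittingField.splits P)
    (fun σ τ h => Gal.ext P (σ := σ) (τ := τ) h) h1 h2 h3
end

section
/- Let F be the field of rational functions in two variables a and b over ℂ (the fraction field of MvPolynomial (Fin 2) ℂ), and let P ∈ F[X] be the quartic P(X) = X⁴ + 2(b - a²)X² - 4abX + (a⁴ - 6a²b + 2b²)/2, where a and b denote the images in F of the two variables. Then the Galois group of P over F is isomorphic, as a group, to the symmetric group on four letters, Equiv.Perm (Fin 4). -/
open Polynomial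

theorem sp4 (y : ℂ[X]) : y^4 + C 2*(X-1)*y^2 - C 4*X*y + (X^2-C 3*X+C (1/2)) ≠ 0 := by
  intro h
  by_cases hn : y.natDegree = 0
  · obtain ⟨c, rfl⟩ := natDegree_eq_zero.mp hn
    have e0 := congrArg (eval 0) h
    have e1 := congrArg (eval 1) h
    have e2 := congrArg (eval (-1)) h
    simp at e0 e1 e2
    grind
  · have h2 : y^4 = -(C 2*(X-1)*y^2) + C 4*X*y - (X^2-C 3*X+C (1/2)) := by linear_combination h
    have h3 : (y^4).natDegree ≤ 2 * y.natDegree + 1 := by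
      rw [h2]
      refine (natDegree_sub_le_of_le (natDegree_add_le_of_degree_le ?_ ?_) ?_ (m := 2 * y.natDegree + 1) (n := 2 * y.natDegree + 1)).trans (by simp)
      · rw [natDegree_neg]
        refine (natDegree_mul_le_of_le (m := 1) (n := 2*y.natDegree) ?_ ?_).trans (by omega)
        · compute_degree
        · exact natDegree_pow_le
      · refine (natDegree_mul_le_of_le (m := 1) (n := y.natDegree) ?_ le_rfl).trans (by omega)
        compute_degree
      · refine le_trans (b := 2) ?_ (by omega)
        compute_degree
    rw [natDegree_pow] at h3
    omega

theorem sp3 (y : ℂ[X]) : y^3 - C 2*(X-1)*y^2 - (C 4*X^2-C 12*X+C 2)*y + (C 8*(X-1)*(X^2-C 3*X+C (1/2)) - C 16*X^2) ≠ 0 := by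
  intro h
  by_cases hn : y.natDegree ≤ 1
  · obtain ⟨d, c, rfl⟩ := exists_eq_X_add_C_of_natDegree_le_one hn
    have e0 := congrArg (eval 0) h
    have e1 := congrArg (eval 1) h
    have e2 := congrArg (eval (-1)) h
    have e3 := congrArg (eval 2) h
    simp at e0 e1 e2 e3
    have k : (d-2)^2*(d+2) = 0 := by linear_combination (e3 - 3*e1+3*e0-e2)/6
    have k' : d = 2 ∨ d = -2 := by
      rcases mul_eq_zero.mp k with k | k
      · left; have := pow_eq_zero_iff (two_ne_zero) |>.mp k; linear_combination this
      · right; linear_combination k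
    rcases k' with rfl | rfl <;> ring_nf at e0 e1 e2 e3
    · have : (16:ℂ) = 0 := by linear_combination -(e1 + e2 -2*e0)/2
      norm_num at this
    · have : c = 4 := by linear_combination (e1 + e2 -2*e0)/32
      subst this
      norm_num at e1
  · have h2 : y^3 = (C 2*(X-1)*y^2) + (C 4*X^2-C 12*X+C 2)*y - (C 8*(X-1)*(X^2-C 3*X+C (1/2)) - C 16*X^2) := by linear_combination h
    have h3 : (y^3).natDegree ≤ 2 * y.natDegree + 1 := by
      rw [h2]
      refine (natDegree_sub_le_of_le (natDegree_add_le_of_degree_le ?_ ?_) ?_ (m := 2 * y.natDegree + 1) (n := 2 * y.natDegree + 1)).trans (by simp)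
      · refine (natDegree_mul_le_of_le (m := 1) (n := 2*y.natDegree) ?_ ?_).trans (by omega)
        · compute_degree
        · exact natDegree_pow_le
      · refine (natDegree_mul_le_of_le (m := 2) (n := y.natDegree) ?_ le_rfl).trans (by omega)
        compute_degree
      · refine le_trans (b := 3) ?_ (by omega)
        compute_degree
    rw [natDegree_pow] at h3
    omega

def disc4 {R : Type*} [CommRing R] (p q r : R) : R :=
  16*p^4*r - 4*p^3*q^2 - 128*p^2*r^2 + 144*p*q^2*r - 27*q^4 + 256*r^3


theorem spD (y : ℂ[X]) : disc4 (2*(X-1)) (-4*X) (X^2-C 3*X+C (1/2)) ≠ y^2 := by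
  intro h
  have : disc4 (2*(X-1)) (-4*X) (X^2-C 3*X+C (1/2)) = C 4096 * X^5 + C (-23552) * X^4
      + C 14080 * X^3 + C (-2368) * X^2 + C (-64) * X + C (32:ℂ) := by
    apply Polynomial.funext; intro t
    simp [disc4]
    ring
  rw [this] at h
  have h1 := congrArg natDegree h
  rw [natDegree_pow] at h1
  have h2 : (C 4096 * X^5 + C (-23552) * X^4
      + C 14080 * X^3 + C (-2368) * X^2 + C (-64) * X + C (32:ℂ)).natDegree = 5 := by
    compute_degree!
  omega

theorem coeffs4 {R : Type*} [CommRing R] {a b c d e a' b' c' d' e' : R}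
    (h : C a * X^4 + C b * X^3 + C c * X^2 + C d * X + C e
      = C a' * X^4 + C b' * X^3 + C c' * X^2 + C d' * X + C e') :
    b = b' ∧ c = c' ∧ d = d' ∧ e = e' := by
  have k3 := congrArg (coeff · 3) h
  have k2 := congrArg (coeff · 2) h
  have k1 := congrArg (coeff · 1) h
  have k0 := congrArg (coeff · 0) h
  simp [coeff_X, coeff_C, coeff_X_pow] at k3 k2 k1 k0
  exact ⟨k3, k2, k1, k0⟩

section general
variable {K : Type*} [Field K] [CharZero K] (p q r : K)

theorem irr4 (h1 : ∀ y : K, y^4 + p*y^2 + q*y + r ≠ 0)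
    (h2 : ∀ y : K, y^3 - p*y^2 - 4*r*y + (4*p*r - q^2) ≠ 0) :
    Irreducible (X^4 + C p * X^2 + C q * X + C r) := by
  have hd : (X^4 + C p * X^2 + C q * X + C r).natDegree = 4 := by compute_degree!
  have hm : (X^4 + C p * X^2 + C q * X + C r).Monic := by monicity!
  rw [hm.irreducible_iff_natDegree']
  refine ⟨fun h => by rw [h] at hd; simp at hd, ?_⟩
  intro f g hf hg hfg hmem
  rw [hd] at hmem
  have hdd : f.natDegree + g.natDegree = 4 := by
    rw [← hd, ← hfg, hf.natDegree_mul hg]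
  simp only [Finset.mem_Ioc] at hmem
  have : g.natDegree = 1 ∨ g.natDegree = 2 := by omega
  rcases this with hg1 | hg2
  · obtain ⟨c, hc⟩ : ∃ c, g = X + C c := ⟨_, hg.eq_X_add_C hg1⟩
    apply h1 (-c)
    have := congrArg (eval (-c)) hfg
    rw [hc] at this
    simp at this
    linear_combination -this
  · have hf2 : f.natDegree = 2 := by omega
    have eg : g = X^2 + C (g.coeff 1) * X + C (g.coeff 0) := by
      have := hg.as_sum
      rw [hg2] at this
      simp [Finset.sum_range_succ] at this
      nth_rewrite 1 [this]
      ring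
    have ef : f = X^2 + C (f.coeff 1) * X + C (f.coeff 0) := by
      have := hf.as_sum
      rw [hf2] at this
      simp [Finset.sum_range_succ] at this
      nth_rewrite 1 [this]
      ring
    generalize g.coeff 1 = u at eg
    generalize g.coeff 0 = v at eg
    generalize f.coeff 1 = u' at ef
    generalize f.coeff 0 = w at ef
    have key : C 1 * X^4 + C (u + u') * X^3 + C (v + w + u*u') * X^2 + C (u*w + v*u') * X + C (v*w)
        = C 1 * X^4 + C 0 * X^3 + C p * X^2 + C q * X + C r := by
      have : (C 1 * X^4 + C 0 * X^3 + C p * X^2 + C q * X + C r : K[X]) =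
        X^4 + C p * X^2 + C q * X + C r := by simp
      rw [this, ← hfg, ef, eg]
      simp only [map_add, map_mul, map_one]
      ring
    obtain ⟨k3, k2, k1, k0⟩ := coeffs4 key
    apply h2 (v + w)
    have : u' = -u := by linear_combination k3
    subst this
    rw [← k2, ← k1, ← k0]
    ring

theorem gal4 (h1 : ∀ y : K, y^4 + p*y^2 + q*y + r ≠ 0)
    (h2 : ∀ y : K, y^3 - p*y^2 - 4*r*y + (4*p*r - q^2) ≠ 0)
    (h3 : ∀ y : K, disc4 p q r ≠ y^2) (P : K[X]) (hP : P = X^4 + C p * X^2 + C q * X + C r) :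
    Nonempty (P.Gal ≃* Equiv.Perm (Fin 4)) := by
  classical
  have hirr : Irreducible P := hP ▸ irr4 p q r h1 h2
  have hd : P.natDegree = 4 := by rw [hP]; compute_degree!
  have hm : P.Monic := by rw [hP]; monicity!
  have hsep : P.Separable := hirr.separable
  let L := P.SplittingField
  have hspl : (P.map (algebraMap K L)).Splits := SplittingField.splits P
  have : Fact ((P.map (algebraMap K L)).Splits) := ⟨hspl⟩
  have : IsGalois K L := IsGalois.of_separable_splitting_field hsep
  have hcard : Fintype.card (P.rootSet L) = 4 := by
    rw [card_rootSet_eq_natDegree hsep hspl, hd]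
  let e : P.rootSet L ≃ Fin 4 := Fintype.equivFinOfCardEq hcard
  let x : Fin 4 → L := fun i => (e.symm i : L)
  have hxinj : Function.Injective x := Subtype.val_injective.comp e.symm.injective
  have hprod : P.map (algebraMap K L) = ∏ i, (X - C (x i)) := by
    rw [hspl.eq_prod_roots_of_monic (hm.map _)]
    have : (P.map (algebraMap K L)).roots = Multiset.map x Finset.univ.val := by
      apply (Multiset.Nodup.ext (nodup_roots hsep.map)
        (Multiset.Nodup.map hxinj Finset.univ.nodup)).mpr
      intro a
      constructor
      · intro ha
        have : a ∈ P.rootSet L := by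
          rw [mem_rootSet']
          rw [mem_roots'] at ha
          refine ⟨ha.1, ?_⟩
          simpa [IsRoot, aeval_def, eval_map] using ha.2
        rw [Multiset.mem_map]
        exact ⟨e ⟨a, this⟩, by simp, by simp [x]⟩
      · rw [Multiset.mem_map]
        rintro ⟨i, -, rfl⟩
        have := (e.symm i).2
        rw [mem_rootSet'] at this
        rw [mem_roots']
        refine ⟨this.1, ?_⟩
        simpa [IsRoot, aeval_def, eval_map] using this.2
    rw [this, Multiset.map_map]
    rfl
  set ι := algebraMap K L with hι
  have key : C 1 * X^4 + C 0 * X^3 + C (ι p) * X^2 + C (ι q) * X + C (ι r)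
     = C 1 * X^4 + C (-(x 0 + x 1 + x 2 + x 3)) * X^3
      + C (x 0 * x 1 + x 0 * x 2 + x 0 * x 3 + x 1 * x 2 + x 1 * x 3 + x 2 * x 3) * X^2
      + C (-(x 0 * x 1 * x 2 + x 0 * x 1 * x 3 + x 0 * x 2 * x 3 + x 1 * x 2 * x 3)) * X
      + C (x 0 * x 1 * x 2 * x 3) := by
    have : (C 1 * X^4 + C 0 * X^3 + C (ι p) * X^2 + C (ι q) * X + C (ι r) : L[X]) =
        P.map ι := by
      refine Eq.trans ?_ (congrArg (map ι) hP).symm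
      simp
    rw [this, hprod, Fin.prod_univ_four]
    simp only [map_add, map_mul, map_one, map_neg]
    ring
  obtain ⟨k3, k2, k1, k0⟩ := coeffs4 key
  have hx3 : x 3 = -(x 0 + x 1 + x 2) := by linear_combination k3
  rw [hx3] at k2 k1 k0
  have hG : Nat.card P.Gal = Module.finrank K L := IsGalois.card_aut_eq_finrank K L
  have d4 : 4 ∣ Nat.card P.Gal := by
    have hx : aeval (x 0) P = 0 := by
      have := (e.symm 0).2
      rw [mem_rootSet'] at this
      exact this.2
    have := minpoly.degree_dvd (Algebra.IsIntegral.isIntegral (R := K) (x 0))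
    rwa [← minpoly.eq_of_irreducible_of_monic hirr hx hm, hd, ← hG] at this
  have d3 : 3 ∣ Nat.card P.Gal := by
    set Q : K[X] := X^3 - C p*X^2 - C (4*r)*X + C (4*p*r - q^2) with hQ
    have hQd : Q.natDegree = 3 := by rw [hQ]; compute_degree!
    have hQm : Q.Monic := by rw [hQ]; monicity!
    have hQi : Irreducible Q := by
      apply irreducible_of_degree_le_three_of_not_isRoot (by simp [hQd])
      intro y hy
      apply h2 y
      simpa [hQ, IsRoot] using hy
    have hx : aeval (x 0 * x 1 + x 2 * x 3) Q = 0 := by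
      simp only [hQ, map_add, map_sub, map_mul, map_pow, aeval_X, aeval_C, ← hι, map_ofNat]
      rw [hx3, k2, k1, k0]
      ring
    have := minpoly.degree_dvd (Algebra.IsIntegral.isIntegral (R := K) (x 0 * x 1 + x 2 * x 3))
    rwa [← minpoly.eq_of_irreducible_of_monic hQi hx hQm, hQd, ← hG] at this
  have d12 : 12 ∣ Nat.card P.Gal := by omega
  let φ : P.Gal →* Equiv.Perm (Fin 4) :=
    (e.permCongrHom : _ →* _).comp (Gal.galActionHom P L)
  have hφ : Function.Injective φ :=
    e.permCongrHom.injective.comp (Gal.galActionHom_injective P L)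
  have hφx : ∀ σ : L ≃ₐ[K] L, ∀ i, x (φ (Gal.restrict P L σ) i) = σ (x i) := by
    intro σ i
    rw [← Gal.galActionHom_restrict]
    simp [φ, x, Equiv.permCongrHom]
  have hrange : Nat.card φ.range = Nat.card P.Gal :=
    (Nat.card_congr (MonoidHom.ofInjective hφ).toEquiv).symm
  have hidx := φ.range.card_mul_index
  have h24 : Nat.card (Equiv.Perm (Fin 4)) = 24 := by
    rw [Nat.card_eq_fintype_card, Fintype.card_perm]; rfl
  rw [hrange, h24] at hidx
  have : φ.range.index = 1 ∨ φ.range.index = 2 := by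
    obtain ⟨m, hm⟩ := d12
    rw [hm] at hidx
    have h' : m * φ.range.index = 2 := by nlinarith
    have : φ.range.index ∣ 2 := ⟨m, by rw [← h', mul_comm]⟩
    exact (Nat.dvd_prime Nat.prime_two).mp this
  rcases this with hi | hi
  · rw [Subgroup.index_eq_one] at hi
    exact ⟨MulEquiv.ofBijective φ ⟨hφ, MonoidHom.range_eq_top.mp hi⟩⟩
  · exfalso
    have halt := Equiv.Perm.eq_alternatingGroup_of_index_eq_two hi
    set δ := (Matrix.vandermonde x).det with hδ
    have hδ2 : δ^2 = ι (disc4 p q r) := by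
      rw [hδ, Matrix.det_vandermonde]
      have : ∏ i, ∏ j > i, (x j - x i) = (x 1 - x 0) * (x 2 - x 0) * (x 3 - x 0) * (x 2 - x 1)
          * (x 3 - x 1) * (x 3 - x 2) := by
        rw [Fin.prod_univ_four]
        rw [show Finset.Ioi (0 : Fin 4) = {1,2,3} by decide, show Finset.Ioi (1 : Fin 4) = {2,3} by decide,
          show Finset.Ioi (2 : Fin 4) = {3} by decide, show Finset.Ioi (3 : Fin 4) = ∅ by decide]
        rw [Finset.prod_insert (by decide), Finset.prod_insert (by decide), Finset.prod_singleton,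
          Finset.prod_insert (by decide), Finset.prod_singleton, Finset.prod_singleton,
          Finset.prod_empty]
        ring
      rw [this]
      simp only [disc4, map_add, map_sub, map_mul, map_pow, map_ofNat]
      rw [hx3, k2, k1, k0]
      ring
    have hfix : ∀ σ : L ≃ₐ[K] L, σ δ = δ := by
      intro σ
      have hs : Equiv.Perm.sign (φ (Gal.restrict P L σ)) = 1 := by
        rw [← Equiv.Perm.mem_alternatingGroup, ← halt]
        exact ⟨_, rfl⟩
      have hp := Matrix.det_permute (φ (Gal.restrict P L σ)) (Matrix.vandermonde x)
      rw [hs] at hp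
      simp only [Units.val_one, Int.cast_one, one_mul] at hp
      rw [hδ, ← hp]
      nth_rewrite 1 [hp]
      rw [AlgEquiv.map_det]
      congr 1
      ext i j
      simp [Matrix.vandermonde_apply]
      rw [← map_pow, hφx, map_pow]
    have hbot := (IsGalois.mem_bot_iff_fixed δ).mpr hfix
    obtain ⟨y, hy⟩ := IntermediateField.mem_bot.mp hbot
    apply h3 y
    apply ι.injective
    rw [← hδ2, map_pow, ← hy]
end general

/-- The Galois group of the quartic
`X⁴ + 2(b-a²)X² - 4abX + (a⁴-6a²b+2b²)/2` over the field `ℂ(a,b)` of rational functions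
is the full symmetric group `S₄`. -/
theorem stmt16 (F : Type) [Field F] [Algebra (MvPolynomial (Fin 2) ℂ) F]
    [IsFractionRing (MvPolynomial (Fin 2) ℂ) F]
    (a b : F)
    (ha : a = algebraMap (MvPolynomial (Fin 2) ℂ) F (MvPolynomial.X 0))
    (hb : b = algebraMap (MvPolynomial (Fin 2) ℂ) F (MvPolynomial.X 1))
    (P : Polynomial F)
    (hP : P = X ^ 4 + C (2 * (b - a ^ 2)) * X ^ 2 - C (4 * a * b) * X +
        C ((a ^ 4 - 6 * a ^ 2 * b + 2 * b ^ 2) / 2)) :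
    Nonempty (P.Gal ≃* Equiv.Perm (Fin 4)) := by
  
  let ι : (MvPolynomial (Fin 2) ℂ) →+* F := algebraMap (MvPolynomial (Fin 2) ℂ) F
  have hι : Function.Injective ι := IsFractionRing.injective (MvPolynomial (Fin 2) ℂ) F
  have : CharZero F := charZero_of_injective_ringHom (f := ι.comp MvPolynomial.C)
    (hι.comp (MvPolynomial.C_injective _ _))
  let u : (MvPolynomial (Fin 2) ℂ) := MvPolynomial.X 0
  let v : (MvPolynomial (Fin 2) ℂ) := MvPolynomial.X 1
  let p : (MvPolynomial (Fin 2) ℂ) := 2 * (v - u^2)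
  let q : (MvPolynomial (Fin 2) ℂ) := -(4 * u * v)
  let r : (MvPolynomial (Fin 2) ℂ) := MvPolynomial.C (1/2) * (u^4 - 6*u^2*v + 2*v^2)
  have h2C : ι (MvPolynomial.C (1/2)) = 1/2 := by
    rw [eq_div_iff two_ne_zero, ← map_ofNat ι 2, ← map_mul, ← map_one ι]
    congr 1
    rw [← map_ofNat MvPolynomial.C 2, ← map_mul]
    norm_num
  have hιu : ι u = a := ha.symm
  have hιv : ι v = b := hb.symm
  have hp : ι p = 2 * (b - a^2) := by simp only [p, map_neg, map_add, map_sub, map_mul, map_pow, map_ofNat, hιu, hιv]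
  have hq : ι q = -(4 * a * b) := by simp only [q, map_neg, map_add, map_sub, map_mul, map_pow, map_ofNat, hιu, hιv]
  have hr : ι r = (a ^ 4 - 6 * a ^ 2 * b + 2 * b ^ 2) / 2 := by
    simp only [r, map_neg, map_add, map_sub, map_mul, map_pow, map_ofNat, h2C, hιu, hιv]
    ring
  let ψ : (MvPolynomial (Fin 2) ℂ) →+* ℂ[X] := MvPolynomial.eval₂Hom C ![1, X]
  have ψu : ψ u = 1 := by simp [ψ, u]
  have ψv : ψ v = X := by simp [ψ, v]
  have ψp : ψ p = 2 * (X - 1) := by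
    simp only [p, map_neg, map_add, map_sub, map_mul, map_pow, map_ofNat, ψu, ψv]
    ring
  have ψq : ψ q = -4*X := by
    simp only [q, map_neg, map_add, map_sub, map_mul, map_pow, map_ofNat, ψu, ψv]
    ring
  have ψr : ψ r = X^2 - C 3 * X + C (1/2) := by
    have : ψ (MvPolynomial.C (1/2)) = C (1/2) := by simp [ψ]
    simp only [r, map_mul, this, map_sub, map_add, map_pow, ψu, ψv, map_ofNat]
    apply Polynomial.funext
    intro t
    simp
    ring
  have lift : ∀ (y : F) (Q : Polynomial (MvPolynomial (Fin 2) ℂ)), Q.Monic → eval₂ ι y Q = 0 → ∃ z : (MvPolynomial (Fin 2) ℂ), ι z = y := by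
    intro y Q hQ hy
    exact IsIntegrallyClosed.isIntegral_iff.mp ⟨Q, hQ, hy⟩
  refine gal4 (ι p) (ι q) (ι r) ?_ ?_ ?_ P ?_
  · intro y hy
    obtain ⟨z, rfl⟩ := lift y (X^4 + C p * X^2 + C q * X + C r) (by monicity!) (by simpa using hy)
    have hz : z^4 + p*z^2 + q*z + r = 0 := hι (by simpa using hy)
    have := congrArg ψ hz
    simp only [map_add, map_sub, map_mul, map_pow, ψp, ψq, ψr, map_zero] at this
    apply sp4 (ψ z)
    rw [← this]
    simp only [map_ofNat]
    ring
  · intro y hy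
    obtain ⟨z, rfl⟩ := lift y (X^3 - C p*X^2 - C (4*r)*X + C (4*p*r - q^2)) (by monicity!)
      (by
        simp only [eval₂_add, eval₂_sub, eval₂_mul, eval₂_pow, eval₂_X, eval₂_C]
        simpa only [map_sub, map_mul, map_pow, map_ofNat] using hy)
    have hz : z^3 - p*z^2 - 4*r*z + (4*p*r - q^2) = 0 := hι (by simpa only [map_add, map_sub, map_mul, map_pow, map_ofNat, map_zero] using hy)
    have := congrArg ψ hz
    simp only [map_add, map_sub, map_mul, map_pow, ψp, ψq, ψr, map_zero, map_ofNat] at this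
    apply sp3 (ψ z)
    rw [← this]
    apply Polynomial.funext
    intro t
    simp
    ring
  · intro y hy
    have hD : disc4 (ι p) (ι q) (ι r) = ι (disc4 p q r) := by
      simp only [disc4, map_add, map_sub, map_mul, map_pow, map_ofNat]
    rw [hD] at hy
    obtain ⟨z, rfl⟩ := lift y (X^2 - C (disc4 p q r)) (by monicity!) (by simp [hy])
    have hz : disc4 p q r = z^2 := hι (by simpa using hy)
    have := congrArg ψ hz
    apply spD (ψ z)
    rw [← map_pow, ← this]
    simp only [disc4, map_add, map_sub, map_mul, map_pow, ψp, ψq, ψr, map_ofNat]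
  · rw [hP, hp, hq, hr]
    simp
    ring
end
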